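/- For all integers m ≥ 2 and n ≥ 2 there exist a finite alphabet Σ of size (m−1)(n−1)+1 and finite languages L₁ and L₂ over Σ with isc(L₁) = m and isc(L₂) = n such that every partial DFA accepting L₁ ∪ L₂ has at least m·n − 2 states and at least 3(m·n − m − n) + 2 defined transitions; that is, isc(L₁ ∪ L₂) ≥ m·n − 2 and itc(L₁ ∪ L₂) ≥ 3(m·n − m − n) + 2. -/

import Mathlib

open scoped Computability
open scoped Classical

/-- A partial DFA over alphabet `α` with state set `Fin n`. -/
structure PDFA (α : Type) (n : ℕ) where
  step : Fin n → α → Option (Fin n)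
  start : Fin n
  accept : Finset (Fin n)

namespace PDFA

variable {α : Type} {n : ℕ}

/-- Run the partial DFA from a state along a word; `none` if a transition is undefined. -/
def evalFrom (M : PDFA α n) : Fin n → List α → Option (Fin n)
  | q, [] => some q
  | q, a :: w => (M.step q a).bind fun q' => M.evalFrom q' w

/-- The language accepted by a partial DFA. -/
def lang (M : PDFA α n) : Language α :=
  {w | ∃ q ∈ M.accept, M.evalFrom M.start w = some q}

/-- The number of defined transitions. -/
noncomputable def transCount [Fintype α] (M : PDFA α n) : ℕ :=
  (Finset.univ.filter fun p : Fin n × α => (M.step p.1 p.2).isSome).card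

/-- The number of defined `τ`-transitions. -/
noncomputable def transCountOn (M : PDFA α n) (τ : α) : ℕ :=
  (Finset.univ.filter fun q : Fin n => (M.step q τ).isSome).card

/-- `s_τ`: 1 if a `τ`-transition is defined at the initial state, else 0. -/
def sOn (M : PDFA α n) (τ : α) : ℕ := if (M.step M.start τ).isSome then 1 else 0

/-- `s`: total over the alphabet of `s_τ`. -/
noncomputable def sTot [Fintype α] (M : PDFA α n) : ℕ := ∑ τ : α, M.sOn τ

/-- `s̄_τ = 1 - s_τ`. -/
def sbarOn (M : PDFA α n) (τ : α) : ℕ := 1 - M.sOn τ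

/-- `a_τ`: the number of defined `τ`-transitions entering a final state. -/
noncomputable def aOn (M : PDFA α n) (τ : α) : ℕ :=
  (Finset.univ.filter fun p : Fin n => ∃ q ∈ M.accept, M.step p τ = some q).card

/-- `e_τ`: the number of final states at which a `τ`-transition is defined. -/
noncomputable def eOn (M : PDFA α n) (τ : α) : ℕ :=
  (M.accept.filter fun q => (M.step q τ).isSome).card

/-- `ē_τ`: the number of final states at which no `τ`-transition is defined. -/
noncomputable def ebarOn (M : PDFA α n) (τ : α) : ℕ :=
  (M.accept.filter fun q => M.step q τ = none).card

/-- `t̄_τ`: the number of states at which no `τ`-transition is defined. -/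
noncomputable def tbarOn (M : PDFA α n) (τ : α) : ℕ :=
  (Finset.univ.filter fun q : Fin n => M.step q τ = none).card

/-- `f(A)`: the number of final states. -/
def fTot (M : PDFA α n) : ℕ := M.accept.card

/-- `f(A, i)`: the number of final states numbered strictly less than `i`. -/
noncomputable def fBelow (M : PDFA α n) (i : ℕ) : ℕ :=
  (M.accept.filter fun q => (q : ℕ) < i).card

/-- `t̄_τ(L, i)`: 1 if no `τ`-transition is defined at state `i`, else 0. -/
noncomputable def tbarAt (M : PDFA α n) (τ : α) (i : ℕ) : ℕ :=
  if h : i < n then (if M.step ⟨i, h⟩ τ = none then 1 else 0) else 0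

/-- The states (numbered by `Fin n`) are topologically ordered: the initial state is `0`
and every defined transition goes from a smaller-numbered to a larger-numbered state. -/
def Ordered (M : PDFA α n) : Prop :=
  (M.start : ℕ) = 0 ∧ ∀ q a q', M.step q a = some q' → q < q'

end PDFA

/-- The incomplete state complexity: the minimal number of states of a partial DFA
accepting `L`. -/
noncomputable def isc {α : Type} (L : Language α) : ℕ :=
  sInf {m | ∃ M : PDFA α m, M.lang = L}

/-- The incomplete transition complexity: the minimal number of defined transitions
over all partial DFAs accepting `L`. -/
noncomputable def itc {α : Type} [Fintype α] (L : Language α) : ℕ :=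
  sInf {t | ∃ m, ∃ M : PDFA α m, M.lang = L ∧ M.transCount = t}

/-- The minimal number of defined `τ`-transitions over all partial DFAs accepting `L`. -/
noncomputable def itcOn {α : Type} (L : Language α) (τ : α) : ℕ :=
  sInf {t | ∃ m, ∃ M : PDFA α m, M.lang = L ∧ M.transCountOn τ = t}


namespace PDFA

variable {α : Type} {n : ℕ}

theorem evalFrom_append (M : PDFA α n) (q : Fin n) (u v : List α) :
    M.evalFrom q (u ++ v) = (M.evalFrom q u).bind fun q' => M.evalFrom q' v := by
  induction u generalizing q with
  | nil => rfl
  | cons a u ih =>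
    simp only [List.cons_append, evalFrom, Option.bind_assoc]
    congr 1
    funext q'
    exact ih q'

theorem exists_evalFrom_of_append_mem (M : PDFA α n) {u v : List α} (h : u ++ v ∈ M.lang) :
    ∃ q, M.evalFrom M.start u = some q := by
  obtain ⟨r, -, hr⟩ := h
  rw [evalFrom_append] at hr
  cases hu : M.evalFrom M.start u with
  | none => simp [hu] at hr
  | some q => exact ⟨q, rfl⟩

theorem append_mem_lang_iff (M : PDFA α n) {u v : List α} {q : Fin n}
    (hq : M.evalFrom M.start u = some q) :
    u ++ v ∈ M.lang ↔ ∃ r ∈ M.accept, M.evalFrom q v = some r := by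
  change (∃ r ∈ M.accept, M.evalFrom M.start (u ++ v) = some r) ↔ _
  rw [evalFrom_append, hq]
  rfl

/-- Access words that are live and pairwise distinguishable reach pairwise distinct states. -/
theorem exists_injOn_states (M : PDFA α n) {ι : Type} {S : Set ι} {w : ι → List α}
    (live : ∀ i ∈ S, ∃ v, w i ++ v ∈ M.lang)
    (dist : ∀ i ∈ S, ∀ j ∈ S, (∀ v, w i ++ v ∈ M.lang ↔ w j ++ v ∈ M.lang) → i = j) :
    ∃ q : ι → Fin n, (∀ i ∈ S, M.evalFrom M.start (w i) = some (q i)) ∧ Set.InjOn q S := by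
  have hex : ∀ i, ∃ q, i ∈ S → M.evalFrom M.start (w i) = some q := by
    intro i
    by_cases hi : i ∈ S
    · obtain ⟨v, hv⟩ := live i hi
      obtain ⟨q, hq⟩ := M.exists_evalFrom_of_append_mem hv
      exact ⟨q, fun _ => hq⟩
    · exact ⟨M.start, fun h => absurd h hi⟩
  choose q hq using hex
  refine ⟨q, hq, fun i hi j hj hij => dist i hi j hj fun v => ?_⟩
  rw [M.append_mem_lang_iff (hq i hi), M.append_mem_lang_iff (hq j hj), hij]

theorem card_le_states (M : PDFA α n) {ι : Type} {S : Finset ι} {w : ι → List α}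
    (live : ∀ i ∈ S, ∃ v, w i ++ v ∈ M.lang)
    (dist : ∀ i ∈ S, ∀ j ∈ S, (∀ v, w i ++ v ∈ M.lang ↔ w j ++ v ∈ M.lang) → i = j) :
    S.card ≤ n := by
  obtain ⟨q, -, hinj⟩ := M.exists_injOn_states (S := (S : Set ι)) live dist
  simpa using Finset.card_le_card_of_injOn q (t := Finset.univ) (by simp [Set.MapsTo]) hinj

theorem card_le_transCount [Fintype α] (M : PDFA α n) {ι : Type} {S : Set ι}
    {T : Finset (ι × α)} {w : ι → List α}
    (dist : ∀ i ∈ S, ∀ j ∈ S, (∀ v, w i ++ v ∈ M.lang ↔ w j ++ v ∈ M.lang) → i = j)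
    (live : ∀ i ∈ S, ∃ v, w i ++ v ∈ M.lang)
    (hT : ∀ p ∈ T, p.1 ∈ S ∧ ∃ v, w p.1 ++ p.2 :: v ∈ M.lang) :
    T.card ≤ M.transCount := by
  obtain ⟨q, hq, hinj⟩ := M.exists_injOn_states live dist
  refine Finset.card_le_card_of_injOn (fun p => (q p.1, p.2)) ?_ ?_
  · intro p hp
    obtain ⟨hS, v, hv⟩ := hT p hp
    rw [M.append_mem_lang_iff (hq _ hS)] at hv
    obtain ⟨r, -, hr⟩ := hv
    simp only [Finset.coe_filter, Finset.mem_univ, true_and, Set.mem_ofPred_eq]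
    cases hs : M.step (q p.1) p.2 with
    | none => simp [evalFrom, hs] at hr
    | some _ => rfl
  · intro p hp p' hp' h
    simp only [Prod.mk.injEq] at h
    exact Prod.ext (hinj (hT p hp).1 (hT p' hp').1 h.1) h.2

/-- A regular language is accepted by some partial DFA. -/
theorem exists_lang_eq_of_isRegular {L : Language α} (hL : L.IsRegular) :
    ∃ k, ∃ M : PDFA α k, M.lang = L := by
  obtain ⟨σ, _, D, rfl⟩ := hL
  let e := Fintype.equivFin σ
  let M : PDFA α (Fintype.card σ) :=
    { step := fun q a => some (e (D.step (e.symm q) a))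
      start := e D.start
      accept := Finset.univ.filter fun q => e.symm q ∈ D.accept }
  have key : ∀ (w : List α) (s : σ), M.evalFrom (e s) w = some (e (D.evalFrom s w)) := by
    intro w
    induction w with
    | nil => intro s; rfl
    | cons a w ih => intro s; simpa [evalFrom, M] using ih (D.step s a)
  refine ⟨_, M, ?_⟩
  ext w
  change (∃ q ∈ M.accept, M.evalFrom (e D.start) w = some q) ↔ D.evalFrom D.start w ∈ D.accept
  simp [key, M]

theorem isRegular_lang (M : PDFA α n) : M.lang.IsRegular := by
  let D : DFA α (Option (Fin n)) :=
    { step := fun s x => s.bind fun q => M.step q x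
      start := some M.start
      accept := {s | ∃ q ∈ M.accept, s = some q} }
  have hnone : ∀ u : List α, D.evalFrom none u = none := by
    intro u
    induction u with
    | nil => rfl
    | cons x u ih => exact ih
  have key : ∀ (u : List α) (q : Fin n), D.evalFrom (some q) u = M.evalFrom q u := by
    intro u
    induction u with
    | nil => intro q; rfl
    | cons x u ih =>
      intro q
      change D.evalFrom (M.step q x) u = (M.step q x).bind fun q' => M.evalFrom q' u
      cases M.step q x with
      | none => exact hnone u
      | some q' => exact ih q'
  refine ⟨_, inferInstance, D, ?_⟩
  ext u
  change (∃ q ∈ M.accept, D.evalFrom (some M.start) u = some q) ↔ _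
  rw [key]
  rfl

end PDFA

/-- The words `x b ⋯ b` with `1 ≤ h x`, of total `h`-weight `N` when `b` has weight `1`. -/
def chainLang {α : Type} (N : ℕ) (h : α → ℕ) (b : α) : Language α :=
  {w | ∃ x, 1 ≤ h x ∧ h x ≤ N ∧ w = x :: List.replicate (N - h x) b}

/-- The partial DFA with states `0, …, N` accepting `chainLang N h b`. -/
noncomputable def chainPDFA {α : Type} (N : ℕ) (h : α → ℕ) (b : α) : PDFA α (N + 1) where
  step q x :=
    if (q : ℕ) = 0 then
      if hx : 1 ≤ h x ∧ h x ≤ N then some ⟨h x, by omega⟩ else none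
    else if hq : x = b ∧ (q : ℕ) < N then some ⟨q + 1, by omega⟩ else none
  start := 0
  accept := {Fin.last N}

section chain

variable {α : Type} {N : ℕ} {h : α → ℕ} {b : α}

theorem cons_mem_chainLang {x : α} {u : List α} :
    x :: u ∈ chainLang N h b ↔ 1 ≤ h x ∧ h x ≤ N ∧ u = List.replicate (N - h x) b := by
  change (∃ y, _) ↔ _
  constructor
  · rintro ⟨y, h1, h2, h3⟩
    obtain ⟨rfl, rfl⟩ := List.cons.inj h3
    exact ⟨h1, h2, rfl⟩
  · rintro ⟨h1, h2, rfl⟩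
    exact ⟨x, h1, h2, rfl⟩

theorem nil_notMem_chainLang : [] ∉ chainLang N h b := by
  rintro ⟨x, -, -, hx⟩
  simp at hx

theorem cons_replicate_mem_chainLang {x : α} {k : ℕ} :
    x :: List.replicate k b ∈ chainLang N h b ↔ 1 ≤ h x ∧ h x + k = N := by
  rw [cons_mem_chainLang, List.replicate_left_inj]
  omega

theorem replicate_mem_chainLang (hN : 1 ≤ N) (hb : h b = 1) {k : ℕ} :
    List.replicate k b ∈ chainLang N h b ↔ k = N := by
  cases k with
  | zero => simp only [List.replicate_zero, nil_notMem_chainLang, false_iff]; omega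
  | succ k => rw [List.replicate_succ, cons_replicate_mem_chainLang]; omega

theorem finite_chainLang [Finite α] : Set.Finite {w | w ∈ chainLang N h b} := by
  refine (Set.finite_range fun x => x :: List.replicate (N - h x) b).subset ?_
  rintro w ⟨x, -, -, rfl⟩
  exact ⟨x, rfl⟩

theorem evalFrom_chainPDFA_eq_last (u : List α) (q : Fin (N + 1)) (hq : (q : ℕ) ≠ 0) :
    (chainPDFA N h b).evalFrom q u = some (Fin.last N) ↔ u = List.replicate (N - q) b := by
  induction u generalizing q with
  | nil =>
    have := q.isLt
    rw [PDFA.evalFrom, Option.some.injEq, Fin.ext_iff, Fin.val_last, eq_comm (a := []),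
      List.replicate_eq_nil_iff]
    omega
  | cons x u ih =>
    by_cases hx : x = b ∧ (q : ℕ) < N
    · have hstep : (chainPDFA N h b).step q x = some ⟨q + 1, by omega⟩ := by
        simp only [chainPDFA, hq, if_false, dif_pos hx]
      obtain ⟨rfl, hlt⟩ := hx
      obtain ⟨d, hd⟩ : ∃ d, N - (q : ℕ) = d + 1 := ⟨N - q - 1, by omega⟩
      rw [PDFA.evalFrom, hstep, Option.bind_some, ih _ (by simp), hd, List.replicate_succ,
        List.cons.injEq]
      simp only [true_and]
      rw [show N - ((q : ℕ) + 1) = d by omega]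
    · have hstep : (chainPDFA N h b).step q x = none := by
        simp only [chainPDFA, hq, if_false, dif_neg hx]
      rw [PDFA.evalFrom, hstep]
      simp only [Option.bind_none, reduceCtorEq, false_iff]
      intro hu
      obtain ⟨d, hd⟩ : ∃ d, N - (q : ℕ) = d + 1 := by
        refine ⟨N - q - 1, ?_⟩
        by_contra hne
        rw [show N - (q : ℕ) = 0 by omega] at hu
        simp at hu
      rw [hd, List.replicate_succ] at hu
      exact hx ⟨(List.cons.inj hu).1, by omega⟩

theorem lang_chainPDFA (hN : 1 ≤ N) : (chainPDFA N h b).lang = chainLang N h b := by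
  ext w
  have hmem : w ∈ (chainPDFA N h b).lang ↔
      (chainPDFA N h b).evalFrom 0 w = some (Fin.last N) := by
    change (∃ q ∈ ({Fin.last N} : Finset (Fin (N + 1))), _) ↔ _
    simp only [Finset.mem_singleton, exists_eq_left]
    rfl
  rw [hmem]
  cases w with
  | nil =>
    simp only [PDFA.evalFrom, nil_notMem_chainLang, iff_false, Option.some.injEq, Fin.ext_iff]
    simp
    omega
  | cons x u =>
    rw [cons_mem_chainLang, ← and_assoc]
    by_cases hx : 1 ≤ h x ∧ h x ≤ N
    · have hstep : (chainPDFA N h b).step 0 x = some ⟨h x, by omega⟩ := by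
        simp [chainPDFA, hx]
      rw [PDFA.evalFrom, hstep, Option.bind_some,
        evalFrom_chainPDFA_eq_last _ _ (show h x ≠ 0 by omega)]
      simp [hx]
    · have hstep : (chainPDFA N h b).step 0 x = none := by
        simp [chainPDFA, hx]
      rw [PDFA.evalFrom, hstep]
      simp [hx]

theorem isc_chainLang (hN : 1 ≤ N) (hb : h b = 1) : isc (chainLang N h b) = N + 1 := by
  have hmem : N + 1 ∈ {m | ∃ M : PDFA α m, M.lang = chainLang N h b} := ⟨_, lang_chainPDFA hN⟩
  refine le_antisymm (Nat.sInf_le hmem) (le_csInf ⟨_, hmem⟩ ?_)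
  rintro k ⟨M, hM⟩
  have happ : ∀ i l, List.replicate i b ++ List.replicate l b ∈ M.lang ↔ i + l = N := by
    intro i l
    rw [hM, ← List.replicate_add, replicate_mem_chainLang hN hb]
  rw [← Finset.card_range (N + 1)]
  refine M.card_le_states (w := fun i => List.replicate i b) ?_ ?_
  · intro i hi
    rw [Finset.mem_range] at hi
    exact ⟨List.replicate (N - i) b, (happ _ _).2 (by omega)⟩
  · intro i hi j hj hij
    rw [Finset.mem_range] at hi hj
    have := hij (List.replicate (N - i) b)
    rw [happ, happ] at this
    omega

end chain

section union

variable {α : Type} {M N : ℕ} {h₁ h₂ : α → ℕ} {b c : α} {a : ℕ → ℕ → α}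

/-- The access word of the state `(i, j)` of the product automaton for the union, where `0`
in a nonzero pair stands for the undefined state of that component. -/
def accessWord (b c : α) (a : ℕ → ℕ → α) (i j : ℕ) : List α :=
  if i = 0 then List.replicate j c else if j = 0 then List.replicate i b else [a i j]

theorem accessWord_swap (a : ℕ → ℕ → α) (i j : ℕ) :
    accessWord c b (fun j i => a i j) j i = accessWord b c a i j := by
  unfold accessWord
  split_ifs <;> simp_all

theorem accessWord_append_mem_chainLang (hM : 1 ≤ M) (hb : h₁ b = 1) (hc : h₁ c = 0)
    {i j k : ℕ} (ha : 1 ≤ i → 1 ≤ j → h₁ (a i j) = i) :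
    accessWord b c a i j ++ List.replicate k b ∈ chainLang M h₁ b ↔
      (1 ≤ i ∨ j = 0) ∧ i + k = M := by
  unfold accessWord
  split_ifs with hi hj
  · cases j with
    | zero =>
      rw [List.replicate_zero, List.nil_append, replicate_mem_chainLang hM hb]
      omega
    | succ j =>
      rw [List.replicate_succ, List.cons_append, cons_mem_chainLang]
      omega
  · rw [← List.replicate_add, replicate_mem_chainLang hM hb]
    omega
  · rw [List.singleton_append, cons_replicate_mem_chainLang, ha (by omega) (by omega)]
    omega

theorem accessWord_append_notMem_chainLang (hbc : b ≠ c) (hb : h₂ b = 0)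
    {i j k : ℕ} (hk : 1 ≤ k) :
    accessWord b c a i j ++ List.replicate k b ∉ chainLang N h₂ c := by
  obtain ⟨k, rfl⟩ : ∃ l, k = l + 1 := ⟨k - 1, by omega⟩
  have hend : ∀ (x : α) (u : List α), b ∈ u → x :: u ∉ chainLang N h₂ c := by
    intro x u hu hmem
    rw [cons_mem_chainLang] at hmem
    rw [hmem.2.2] at hu
    exact hbc (List.eq_of_mem_replicate hu)
  have hstart : ∀ u : List α, b :: u ∉ chainLang N h₂ c := by
    intro u hmem
    rw [cons_mem_chainLang] at hmem
    omega
  unfold accessWord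
  split_ifs with hi hj
  · cases j with
    | zero => exact hstart _
    | succ j => exact hend _ _ (by simp)
  · obtain ⟨i, rfl⟩ : ∃ l, i = l + 1 := ⟨i - 1, by omega⟩
    exact hstart _
  · exact hend _ _ (by simp)

/-- The pairwise inequivalent states of the product automaton: the states `(M, N)` and `(0, N)`
are equivalent to `(M, 0)`. -/
def unionStates (M N : ℕ) : Finset (ℕ × ℕ) :=
  (Finset.range (M + 1) ×ˢ Finset.range (N + 1)) \ {(M, N), (0, N)}

theorem mem_unionStates {p : ℕ × ℕ} : p ∈ unionStates M N ↔
    p.1 ≤ M ∧ p.2 ≤ N ∧ ¬(p.1 = M ∧ p.2 = N) ∧ ¬(p.1 = 0 ∧ p.2 = N) := by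
  simp only [unionStates, Finset.mem_sdiff, Finset.mem_product, Finset.mem_range,
    Finset.mem_insert, Finset.mem_singleton, Prod.ext_iff]
  omega

theorem card_unionStates (hM : 1 ≤ M) : (unionStates M N).card = (M + 1) * (N + 1) - 2 := by
  rw [unionStates, Finset.card_sdiff_of_subset, Finset.card_product, Finset.card_range,
    Finset.card_range, Finset.card_pair]
  · simp only [ne_eq, Prod.mk.injEq, and_true]
    omega
  · intro p hp
    simp only [Finset.mem_insert, Finset.mem_singleton] at hp
    rcases hp with rfl | rfl <;> simp

/-- Transitions of the product automaton between the states `unionStates`. -/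
noncomputable def unionTrans [Fintype α] (M N : ℕ) (b c : α) : Finset ((ℕ × ℕ) × α) :=
  {(0, 0)} ×ˢ Finset.univ ∪
    ((Finset.Icc 1 (M - 1) ×ˢ Finset.range (N + 1)) ×ˢ {b} ∪
      (Finset.range (M + 1) ×ˢ Finset.Icc 1 (N - 1)) ×ˢ {c})

theorem mem_unionTrans [Fintype α] {p : (ℕ × ℕ) × α} : p ∈ unionTrans M N b c ↔
    (p.1.1 = 0 ∧ p.1.2 = 0) ∨
      (((1 ≤ p.1.1 ∧ p.1.1 ≤ M - 1) ∧ p.1.2 ≤ N) ∧ p.2 = b) ∨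
      ((p.1.1 ≤ M ∧ 1 ≤ p.1.2 ∧ p.1.2 ≤ N - 1) ∧ p.2 = c) := by
  simp only [unionTrans, Finset.mem_union, Finset.mem_product, Finset.mem_singleton,
    Finset.mem_univ, Finset.mem_Icc, Finset.mem_range, Prod.ext_iff, Nat.lt_succ_iff, and_true]

theorem card_unionTrans [Fintype α] (hbc : b ≠ c) :
    (unionTrans M N b c).card =
      Fintype.card α + ((M - 1) * (N + 1) + (M + 1) * (N - 1)) := by
  rw [unionTrans, Finset.card_union_of_disjoint, Finset.card_union_of_disjoint]
  · simp only [Finset.card_product, Finset.card_singleton, Finset.card_univ, Finset.card_range,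
      Nat.card_Icc, one_mul, mul_one, Nat.add_sub_cancel]
  · rw [Finset.disjoint_left]
    rintro ⟨⟨i, j⟩, x⟩ hp hp'
    simp only [Finset.mem_product, Finset.mem_singleton] at hp hp'
    exact hbc (hp.2.symm.trans hp'.2)
  · rw [Finset.disjoint_left]
    rintro ⟨⟨i, j⟩, x⟩ hp hp'
    simp only [Finset.mem_union, Finset.mem_product, Finset.mem_singleton, Finset.mem_Icc,
      Prod.ext_iff] at hp hp'
    omega

theorem union_chainLang_lower_bound [Fintype α] (hM : 1 ≤ M) (hN : 1 ≤ N)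
    (h1b : h₁ b = 1) (h1c : h₁ c = 0) (h2b : h₂ b = 0) (h2c : h₂ c = 1)
    (h1 : ∀ x, h₁ x ≤ M) (h2 : ∀ x, h₂ x ≤ N) (hpos : ∀ x, 1 ≤ h₁ x ∨ 1 ≤ h₂ x)
    (hsurj : ∀ i j, 1 ≤ i → 1 ≤ j → i ≤ M → j ≤ N → ¬(i = M ∧ j = N) →
      ∃ x, h₁ x = i ∧ h₂ x = j)
    {k : ℕ} (A : PDFA α k) (hA : A.lang = chainLang M h₁ b ⊔ chainLang N h₂ c) :
    (M + 1) * (N + 1) - 2 ≤ k ∧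
      Fintype.card α + ((M - 1) * (N + 1) + (M + 1) * (N - 1)) ≤ A.transCount := by
  have hbc : b ≠ c := by
    rintro rfl
    omega
  have hex : ∀ i j, ∃ x, 1 ≤ i → 1 ≤ j → i ≤ M → j ≤ N → ¬(i = M ∧ j = N) →
      h₁ x = i ∧ h₂ x = j := by
    intro i j
    by_cases h : 1 ≤ i ∧ 1 ≤ j ∧ i ≤ M ∧ j ≤ N ∧ ¬(i = M ∧ j = N)
    · obtain ⟨hi, hj, hi', hj', hij⟩ := h
      obtain ⟨x, hx⟩ := hsurj i j hi hj hi' hj' hij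
      exact ⟨x, fun _ _ _ _ _ => hx⟩
    · exact ⟨b, by tauto⟩
  choose a ha using hex
  have hsup : ∀ u, u ∈ A.lang ↔ u ∈ chainLang M h₁ b ∨ u ∈ chainLang N h₂ c := by
    intro u
    rw [hA]
    rfl
  let w : ℕ × ℕ → List α := fun p => accessWord b c a p.1 p.2
  have hw1 : ∀ p ∈ unionStates M N, ∀ l, w p ++ List.replicate l b ∈ chainLang M h₁ b ↔
      (1 ≤ p.1 ∨ p.2 = 0) ∧ p.1 + l = M := by
    intro p hp l
    rw [mem_unionStates] at hp
    exact accessWord_append_mem_chainLang hM h1b h1c fun hi hj =>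
      (ha _ _ hi hj hp.1 hp.2.1 hp.2.2.1).1
  have hw2 : ∀ p ∈ unionStates M N, ∀ l, w p ++ List.replicate l c ∈ chainLang N h₂ c ↔
      (1 ≤ p.2 ∨ p.1 = 0) ∧ p.2 + l = N := by
    intro p hp l
    rw [mem_unionStates] at hp
    simp only [w]
    rw [← accessWord_swap]
    exact accessWord_append_mem_chainLang hN h2c h2b fun hj hi =>
      (ha _ _ hi hj hp.1 hp.2.1 hp.2.2.1).2
  have hmem_b : ∀ p ∈ unionStates M N, ∀ l, 1 ≤ l →
      (w p ++ List.replicate l b ∈ A.lang ↔ (1 ≤ p.1 ∨ p.2 = 0) ∧ p.1 + l = M) := by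
    intro p hp l hl
    rw [hsup, hw1 p hp l, or_iff_left (accessWord_append_notMem_chainLang hbc h2b hl)]
  have hmem_c : ∀ p ∈ unionStates M N, ∀ l, 1 ≤ l →
      (w p ++ List.replicate l c ∈ A.lang ↔ (1 ≤ p.2 ∨ p.1 = 0) ∧ p.2 + l = N) := by
    intro p hp l hl
    rw [hsup, hw2 p hp l, or_iff_right]
    simp only [w]
    rw [← accessWord_swap]
    exact accessWord_append_notMem_chainLang hbc.symm h1c hl
  have hmem_nil : ∀ p ∈ unionStates M N, (w p ++ [] ∈ A.lang ↔
      ((1 ≤ p.1 ∨ p.2 = 0) ∧ p.1 = M) ∨ ((1 ≤ p.2 ∨ p.1 = 0) ∧ p.2 = N)) := by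
    intro p hp
    rw [hsup]
    exact or_congr (hw1 p hp 0) (hw2 p hp 0)
  have live : ∀ p ∈ unionStates M N, ∃ v, w p ++ v ∈ A.lang := by
    intro p hp
    by_cases hi : 1 ≤ p.1
    · refine ⟨List.replicate (M - p.1) b, (hsup _).2 (Or.inl ((hw1 p hp _).2 ?_))⟩
      rw [mem_unionStates] at hp
      omega
    · refine ⟨List.replicate (N - p.2) c, (hsup _).2 (Or.inr ((hw2 p hp _).2 ?_))⟩
      rw [mem_unionStates] at hp
      omega
  have dist : ∀ p ∈ unionStates M N, ∀ q ∈ unionStates M N,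
      (∀ v, w p ++ v ∈ A.lang ↔ w q ++ v ∈ A.lang) → p = q := by
    intro p hp q hq hpq
    have e0 := hpq []
    rw [hmem_nil p hp, hmem_nil q hq] at e0
    have eb : ∀ l, 1 ≤ l → _ := fun l hl =>
      (hmem_b p hp l hl).symm.trans ((hpq _).trans (hmem_b q hq l hl))
    have ec : ∀ l, 1 ≤ l → _ := fun l hl =>
      (hmem_c p hp l hl).symm.trans ((hpq _).trans (hmem_c q hq l hl))
    rw [mem_unionStates] at hp hq
    have eb1 := eb (M - p.1)
    have eb2 := eb (M - q.1)
    have ec1 := ec (N - p.2)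
    have ec2 := ec (N - q.2)
    obtain ⟨i, j⟩ := p
    obtain ⟨i', j'⟩ := q
    clear eb ec hpq hmem_nil hmem_b hmem_c hw1 hw2 hsup
    simp only [Prod.mk.injEq] at *
    omega
  refine ⟨?_, ?_⟩
  · rw [← card_unionStates hM]
    exact A.card_le_states live dist
  · rw [← card_unionTrans hbc]
    refine A.card_le_transCount (S := (unionStates M N : Set (ℕ × ℕ))) dist live ?_
    rintro ⟨⟨i, j⟩, x⟩ hp
    rw [mem_unionTrans] at hp
    have hS : ((i, j) : ℕ × ℕ) ∈ unionStates M N := by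
      rw [mem_unionStates]
      dsimp only at hp ⊢
      omega
    refine ⟨hS, ?_⟩
    rcases hp with ⟨hi, hj⟩ | ⟨⟨⟨hi, hi'⟩, hj⟩, hx⟩ | ⟨⟨hi, hj, hj'⟩, hx⟩ <;>
      dsimp only at *
    · subst hi hj
      rcases hpos x with hx | hx
      · exact ⟨_, (hsup _).2 (Or.inl (cons_mem_chainLang.2 ⟨hx, h1 x, rfl⟩))⟩
      · exact ⟨_, (hsup _).2 (Or.inr (cons_mem_chainLang.2 ⟨hx, h2 x, rfl⟩))⟩
    · subst hx
      refine ⟨List.replicate (M - i - 1) x, ?_⟩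
      rw [← List.replicate_succ, hmem_b _ hS _ (by omega)]
      dsimp only
      omega
    · subst hx
      refine ⟨List.replicate (N - j - 1) x, ?_⟩
      rw [← List.replicate_succ, hmem_c _ hS _ (by omega)]
      dsimp only
      omega

end union

section letters

variable {M N : ℕ}

/-- First component of the letter numbered `x`: the letters `0, …, M * N - 2` enumerate the pairs
`(i, j) ≠ (M, N)` with `1 ≤ i ≤ M` and `1 ≤ j ≤ N`, and the last two are `(1, 0)` and `(0, 1)`. -/
def letterWeight₁ (M N : ℕ) (x : Fin (M * N + 1)) : ℕ :=
  if (x : ℕ) < M * N - 1 then x / N + 1 else if (x : ℕ) = M * N - 1 then 1 else 0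

/-- Second component of the letter numbered `x`; see `letterWeight₁`. -/
def letterWeight₂ (M N : ℕ) (x : Fin (M * N + 1)) : ℕ :=
  if (x : ℕ) < M * N - 1 then x % N + 1 else if (x : ℕ) = M * N - 1 then 0 else 1

theorem letterWeight₁_le (hM : 1 ≤ M) (x : Fin (M * N + 1)) : letterWeight₁ M N x ≤ M := by
  unfold letterWeight₁
  split_ifs with hx
  · exact Nat.div_lt_of_lt_mul (by have := mul_comm N M; omega)
  · exact hM
  · exact Nat.zero_le _

theorem letterWeight₂_le (hN : 1 ≤ N) (x : Fin (M * N + 1)) : letterWeight₂ M N x ≤ N := by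
  unfold letterWeight₂
  split_ifs
  · exact Nat.mod_lt _ hN
  · exact Nat.zero_le _
  · exact hN

theorem one_le_letterWeight (x : Fin (M * N + 1)) :
    1 ≤ letterWeight₁ M N x ∨ 1 ≤ letterWeight₂ M N x := by
  unfold letterWeight₁ letterWeight₂
  split_ifs <;> simp

theorem exists_letter {i j : ℕ} (hi : 1 ≤ i) (hj : 1 ≤ j) (hi' : i ≤ M) (hj' : j ≤ N)
    (hij : ¬(i = M ∧ j = N)) :
    ∃ x : Fin (M * N + 1), letterWeight₁ M N x = i ∧ letterWeight₂ M N x = j := by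
  obtain ⟨r, rfl⟩ : ∃ r, i = r + 1 := ⟨i - 1, by omega⟩
  obtain ⟨s, rfl⟩ : ∃ s, j = s + 1 := ⟨j - 1, by omega⟩
  have hlt : N * r + s < M * N - 1 := by
    rcases Nat.lt_or_ge (r + 1) M with hr | hr
    · have := Nat.mul_le_mul_right N (show r + 2 ≤ M by omega)
      have : (r + 2) * N = N * r + 2 * N := by ring
      omega
    · obtain rfl : M = r + 1 := by omega
      have : (r + 1) * N = N * r + N := by ring
      omega
  refine ⟨⟨N * r + s, by omega⟩, ?_, ?_⟩
  · simp only [letterWeight₁, if_pos hlt]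
    rw [Nat.mul_add_div (by omega), Nat.div_eq_of_lt (by omega), add_zero]
  · simp only [letterWeight₂, if_pos hlt]
    rw [Nat.mul_add_mod, Nat.mod_eq_of_lt (by omega)]

end letters

/-- Tightness of the bounds for union: for all `m, n ≥ 2` there are
finite languages over an alphabet of size `(m−1)(n−1)+1` with `isc L₁ = m`, `isc L₂ = n`
such that every partial DFA accepting `L₁ ∪ L₂` needs at least `m·n − 2` states and
`3(m·n − n − m) + 2` transitions. -/
theorem union_tight {m n : ℕ} (hm : 2 ≤ m) (hn : 2 ≤ n) :
    ∃ L₁ L₂ : Language (Fin ((m - 1) * (n - 1) + 1)),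
      Set.Finite {w | w ∈ L₁} ∧ Set.Finite {w | w ∈ L₂} ∧
      isc L₁ = m ∧ isc L₂ = n ∧
      (∀ (k : ℕ) (M : PDFA (Fin ((m - 1) * (n - 1) + 1)) k), M.lang = L₁ ⊔ L₂ →
        m * n - 2 ≤ k ∧ 3 * (m * n - n - m) + 2 ≤ M.transCount) ∧
      m * n - 2 ≤ isc (L₁ ⊔ L₂) ∧ 3 * (m * n - n - m) + 2 ≤ itc (L₁ ⊔ L₂) := by
  obtain ⟨M, rfl⟩ : ∃ M, m = M + 1 := ⟨m - 1, by omega⟩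
  obtain ⟨N, rfl⟩ : ∃ N, n = N + 1 := ⟨n - 1, by omega⟩
  have hM : 1 ≤ M := by omega
  have hN : 1 ≤ N := by omega
  have hMN : 1 ≤ M * N := Nat.mul_pos hM hN
  let b : Fin (M * N + 1) := ⟨M * N - 1, by omega⟩
  let c : Fin (M * N + 1) := ⟨M * N, by omega⟩
  let h₁ : Fin (M * N + 1) → ℕ := letterWeight₁ M N
  let h₂ : Fin (M * N + 1) → ℕ := letterWeight₂ M N
  have h1b : h₁ b = 1 := by simp [h₁, letterWeight₁, b]
  have h2b : h₂ b = 0 := by simp [h₂, letterWeight₂, b]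
  have h1c : h₁ c = 0 := by
    simp only [h₁, letterWeight₁, c]
    rw [if_neg (by omega), if_neg (by omega)]
  have h2c : h₂ c = 1 := by
    simp only [h₂, letterWeight₂, c]
    rw [if_neg (by omega), if_neg (by omega)]
  have hbound : ∀ (k : ℕ) (A : PDFA (Fin (M * N + 1)) k),
      A.lang = chainLang M h₁ b ⊔ chainLang N h₂ c →
      (M + 1) * (N + 1) - 2 ≤ k ∧
        3 * ((M + 1) * (N + 1) - (N + 1) - (M + 1)) + 2 ≤ A.transCount := by
    intro k A hA
    obtain ⟨hstates, htrans⟩ := union_chainLang_lower_bound hM hN h1b h1c h2b h2c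
      (fun x => letterWeight₁_le hM x) (fun x => letterWeight₂_le hN x)
      (fun x => one_le_letterWeight x)
      (fun i j hi hj hi' hj' hij => exists_letter hi hj hi' hj' hij) A hA
    refine ⟨hstates, le_trans (le_of_eq ?_) htrans⟩
    obtain ⟨r, rfl⟩ : ∃ r, M = r + 1 := ⟨M - 1, by omega⟩
    obtain ⟨s, rfl⟩ : ∃ s, N = s + 1 := ⟨N - 1, by omega⟩
    rw [Fintype.card_fin, Nat.add_sub_cancel, Nat.add_sub_cancel]
    have hsub : (r + 1 + 1) * (s + 1 + 1) - (s + 1 + 1) - (r + 1 + 1) = r * s + r + s := by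
      rw [show (r + 1 + 1) * (s + 1 + 1) = r * s + r + s + (r + 1 + 1) + (s + 1 + 1) by ring]
      omega
    rw [hsub]
    ring
  obtain ⟨k, A, hA⟩ : ∃ k, ∃ A : PDFA (Fin (M * N + 1)) k,
      A.lang = chainLang M h₁ b ⊔ chainLang N h₂ c := by
    refine PDFA.exists_lang_eq_of_isRegular (Language.IsRegular.add ?_ ?_)
    · rw [← lang_chainPDFA hM]
      exact PDFA.isRegular_lang _
    · rw [← lang_chainPDFA hN]
      exact PDFA.isRegular_lang _
  refine ⟨chainLang M h₁ b, chainLang N h₂ c, finite_chainLang, finite_chainLang,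
    isc_chainLang hM h1b, isc_chainLang hN h2c, hbound, ?_, ?_⟩
  · refine le_csInf ⟨k, A, hA⟩ ?_
    rintro l ⟨B, hB⟩
    exact (hbound l B hB).1
  · refine le_csInf ⟨_, k, A, hA, rfl⟩ ?_
    rintro t ⟨l, B, hB, rfl⟩
    exact (hbound l B hB).2
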